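/- (Theorem 2.1) Suppose δ₀ : ℝ^n → ℝ is measurable and location equivariant, and for every x ∈ ℝ^n it minimizes the flat-prior posterior loss: for all d ∈ ℝ, ∫_ℝ L(δ₀(x) − μ) f(x − μ) dμ ≤ ∫_ℝ L(d − μ) f(x − μ) dμ. Then δ₀ is best equivariant: for every measurable location-equivariant estimator δ : ℝ^n → ℝ and every μ ∈ ℝ, R(δ₀, μ) ≤ R(δ, μ). -/

import Mathlib

open MeasureTheory ENNReal

/-- The integral over `ℝ^ι` equals the integral of the diagonal-orbit integrals over the slab
where a fixed coordinate lies in `[0, 1]`. -/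
theorem lintegral_eq_setLIntegral_lintegral_sub_diagonal {ι : Type*} [Fintype ι] (i : ι)
    {G : (ι → ℝ) → ℝ≥0∞} (hG : Measurable G) :
    ∫⁻ x, G x =
      ∫⁻ x in {x : ι → ℝ | x i ∈ Set.Icc 0 1}, ∫⁻ t : ℝ, G (fun j => x j - t) := by
  set w : ℝ → ℝ≥0∞ := (Set.Icc 0 1).indicator 1 with hw
  have hwm : Measurable w := measurable_one.indicator measurableSet_Icc
  have hw1 : ∀ a : ℝ, ∫⁻ t : ℝ, w (a + t) = 1 := fun a => by
    rw [lintegral_add_left_eq_self w a, hw, lintegral_indicator_one measurableSet_Icc]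
    simp
  calc ∫⁻ x, G x = ∫⁻ x : ι → ℝ, ∫⁻ t : ℝ, G x * w (x i + t) := by
        refine lintegral_congr fun x => ?_
        rw [lintegral_const_mul _ (by fun_prop), hw1, mul_one]
    _ = ∫⁻ t : ℝ, ∫⁻ x : ι → ℝ, G x * w (x i + t) :=
        lintegral_lintegral_swap (by fun_prop)
    _ = ∫⁻ t : ℝ, ∫⁻ x : ι → ℝ, G (fun j => x j - t) * w (x i) := by
        refine lintegral_congr fun t => ?_
        rw [← lintegral_sub_right_eq_self (fun x : ι → ℝ => G x * w (x i + t)) (fun _ => t)]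
        refine lintegral_congr fun x => ?_
        simp only [Pi.sub_apply, sub_add_cancel]
        rfl
    _ = ∫⁻ x : ι → ℝ, ∫⁻ t : ℝ, G (fun j => x j - t) * w (x i) :=
        lintegral_lintegral_swap (by fun_prop)
    _ = _ := by
        have hslab : MeasurableSet {x : ι → ℝ | x i ∈ Set.Icc 0 1} :=
          measurableSet_Icc.preimage (measurable_pi_apply i)
        rw [← lintegral_indicator hslab]
        refine lintegral_congr fun x => ?_
        rw [lintegral_mul_const _ (by fun_prop)]
        by_cases hx : x i ∈ Set.Icc (0 : ℝ) 1 <;> simp only [hw, Set.indicator, hx,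
          Set.mem_ofPred_eq, if_true, if_false, Pi.one_apply, mul_one, mul_zero]

/-- (Theorem 2.1) If a measurable location-equivariant estimator `δ₀` minimizes, for
every `x`, the posterior loss under the flat prior `π(μ) = 1`, then it is best
equivariant: its risk is no larger than that of any measurable location-equivariant
estimator, at every value of the location parameter. -/
theorem best_location_equivariant
    (n : ℕ) (f : (Fin n → ℝ) → ℝ) (hfm : Measurable f) (hf0 : ∀ x, 0 ≤ f x)
    (hf1 : ∫ x, f x = 1)
    (L : ℝ → ℝ≥0∞) (hL : Measurable L)
    (δ₀ : (Fin n → ℝ) → ℝ) (hδ₀m : Measurable δ₀)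
    (hδ₀eq : ∀ (x : Fin n → ℝ) (c : ℝ), δ₀ (fun i => x i - c) = δ₀ x - c)
    (hmin : ∀ (x : Fin n → ℝ) (d : ℝ),
      ∫⁻ μ : ℝ, L (δ₀ x - μ) * ENNReal.ofReal (f (fun i => x i - μ)) ≤
        ∫⁻ μ : ℝ, L (d - μ) * ENNReal.ofReal (f (fun i => x i - μ))) :
    ∀ (δ : (Fin n → ℝ) → ℝ), Measurable δ →
      (∀ (x : Fin n → ℝ) (c : ℝ), δ (fun i => x i - c) = δ x - c) →
      ∀ μ : ℝ,
        ∫⁻ x, L (δ₀ x - μ) * ENNReal.ofReal (f (fun i => x i - μ)) ≤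
          ∫⁻ x, L (δ x - μ) * ENNReal.ofReal (f (fun i => x i - μ)) := by
  intro δ hδm hδeq μ
  obtain rfl | hn := Nat.eq_zero_or_pos n
  · have h := hδ₀eq 0 1
    rw [Subsingleton.elim (fun i => (0 : Fin 0 → ℝ) i - 1) 0] at h
    linarith
  have risk_eq : ∀ η : (Fin n → ℝ) → ℝ, Measurable η →
      (∀ (x : Fin n → ℝ) (c : ℝ), η (fun i => x i - c) = η x - c) →
      ∫⁻ x, L (η x - μ) * ENNReal.ofReal (f (fun i => x i - μ)) =
        ∫⁻ x in {x : Fin n → ℝ | x ⟨0, hn⟩ ∈ Set.Icc 0 1},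
          ∫⁻ t : ℝ, L (η x - t) * ENNReal.ofReal (f (fun i => x i - t)) := by
    intro η hη hηeq
    have h := lintegral_eq_setLIntegral_lintegral_sub_diagonal ⟨0, hn⟩
      (G := fun x => L (η x) * ENNReal.ofReal (f x)) (by fun_prop)
    simp only [hηeq] at h
    rw [← h, ← lintegral_sub_right_eq_self (fun x => L (η x) * _) (fun _ => μ)]
    refine lintegral_congr fun x => ?_
    rw [← hηeq]
    rfl
  rw [risk_eq δ₀ hδ₀m hδ₀eq, risk_eq δ hδm hδeq]
  exact lintegral_mono fun x => hmin x (δ x)
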